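/- arXiv:2604.08949 — 2 statements merged into one kernel-verified Lean document; each statement's English description precedes it below -/
import Mathlib

section
/- Let d ≥ 1, let γ > 0, and let u ∈ ℝ^d be a unit vector (‖u‖ = 1). Then the pushforward under the map n ↦ ⟪u, n⟫ of the measure on ℝ^d whose density with respect to Lebesgue measure is f_γ equals the measure on ℝ whose density with respect to Lebesgue measure is the one-dimensional Cauchy density z ↦ (1/(πγ)) · 1/(1 + (z/γ)²); that is, every one-dimensional projection of the isotropic multivariate Cauchy law onto a unit direction is the scalar Cauchy law with location 0 and scale γ. -/
open MeasureTheory Real Filter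
open scoped RealInnerProductSpace Topology

noncomputable def cC (d : ℕ) : ℝ :=
  Real.Gamma (((d : ℝ) + 1) / 2) / Real.pi ^ (((d : ℝ) + 1) / 2)

noncomputable def fC (d : ℕ) (γ : ℝ) (n : EuclideanSpace ℝ (Fin d)) : ℝ :=
  cC d * γ ^ (-(d : ℝ)) * (1 + ‖n‖ ^ 2 / γ ^ 2) ^ (-(((d : ℝ) + 1) / 2))

theorem lintegral_eq_lintegral_span_singleton_orthogonal {E : Type*} [NormedAddCommGroup E]
    [InnerProductSpace ℝ E] [FiniteDimensional ℝ E] [MeasurableSpace E] [BorelSpace E]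
    {u : E} (hu : ‖u‖ = 1) {F : E → ENNReal} (hF : Measurable F) :
    ∫⁻ x, F x = ∫⁻ z : ℝ, ∫⁻ v : (ℝ ∙ u)ᗮ, F (z • u + v) := by
  have hline : MeasurePreserving (LinearIsometryEquiv.toSpanUnitSingleton (𝕜 := ℝ) u hu) :=
    LinearIsometryEquiv.measurePreserving _
  have hsum : MeasurePreserving
      (fun p : ℝ × (ℝ ∙ u)ᗮ => p.1 • u + (p.2 : E)) (volume.prod volume) volume :=
    (ℝ ∙ u).orthogonalDecomposition.symm.measurePreserving.comp
      ((WithLp.volume_preserving_toLp _ _).comp (hline.prod (MeasurePreserving.id volume)))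
  rw [← hsum.lintegral_comp hF]
  exact lintegral_prod _ (hF.comp hsum.measurable).aemeasurable

theorem lintegral_rpow_mul_exp_neg_mul_Ioi {a r : ℝ} (ha : 0 < a) (hr : 0 < r) :
    ∫⁻ t in Set.Ioi (0 : ℝ), ENNReal.ofReal (t ^ (a - 1) * exp (-(r * t)))
      = ENNReal.ofReal ((1 / r) ^ a * Real.Gamma a) := by
  have hint := integral_rpow_mul_exp_neg_mul_Ioi ha hr
  rw [← hint, ofReal_integral_eq_lintegral_ofReal]
  · apply Integrable.of_integral_ne_zero
    rw [hint]
    positivity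
  · filter_upwards [self_mem_ae_restrict measurableSet_Ioi] with t ht
    have : 0 < t := ht
    positivity

section

variable {V : Type*} [NormedAddCommGroup V] [InnerProductSpace ℝ V] [FiniteDimensional ℝ V]
  [MeasurableSpace V] [BorelSpace V]

theorem lintegral_exp_neg_mul_sq_norm {b : ℝ} (hb : 0 < b) :
    ∫⁻ v : V, ENNReal.ofReal (exp (-b * ‖v‖ ^ 2))
      = ENNReal.ofReal ((π / b) ^ (Module.finrank ℝ V / 2 : ℝ)) := by
  have hint := GaussianFourier.integral_rexp_neg_mul_sq_norm (V := V) hb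
  rw [← hint, ofReal_integral_eq_lintegral_ofReal]
  · apply Integrable.of_integral_ne_zero
    rw [hint]
    positivity
  · exact ae_of_all _ fun v => (exp_pos _).le

/-- Radial integral of a power of a positive quadratic, obtained by writing the power as a mixture
of Gaussians. -/
theorem lintegral_add_mul_sq_norm_rpow_neg {a c w : ℝ} (ha : (Module.finrank ℝ V / 2 : ℝ) < a)
    (hc : 0 < c) (hw : 0 < w) :
    ∫⁻ v : V, ENNReal.ofReal ((w + c * ‖v‖ ^ 2) ^ (-a))
      = ENNReal.ofReal ((π / c) ^ (Module.finrank ℝ V / 2 : ℝ)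
          * (Real.Gamma (a - Module.finrank ℝ V / 2) / Real.Gamma a)
          * w ^ (-(a - Module.finrank ℝ V / 2))) := by
  set k : ℝ := Module.finrank ℝ V / 2
  have hk : 0 ≤ k := by positivity
  have ha0 : 0 < a := hk.trans_lt ha
  have hak : 0 < a - k := sub_pos.2 ha
  have hmix (v : V) : ENNReal.ofReal ((w + c * ‖v‖ ^ 2) ^ (-a))
      = ENNReal.ofReal (Real.Gamma a)⁻¹ * ∫⁻ t in Set.Ioi (0 : ℝ),
          ENNReal.ofReal (t ^ (a - 1) * exp (-((w + c * ‖v‖ ^ 2) * t))) := by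
    rw [lintegral_rpow_mul_exp_neg_mul_Ioi ha0 (by positivity),
      ← ENNReal.ofReal_mul (by positivity), one_div, inv_rpow (by positivity),
      rpow_neg (by positivity)]
    congr 1
    field_simp
  have hgauss {t : ℝ} (ht : 0 < t) :
      ∫⁻ v : V, ENNReal.ofReal (t ^ (a - 1) * exp (-((w + c * ‖v‖ ^ 2) * t)))
        = ENNReal.ofReal ((π / c) ^ k) *
          ENNReal.ofReal (t ^ (a - k - 1) * exp (-(w * t))) := by
    have hsplit (v : V) : ENNReal.ofReal (t ^ (a - 1) * exp (-((w + c * ‖v‖ ^ 2) * t)))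
        = ENNReal.ofReal (t ^ (a - 1) * exp (-(w * t)))
          * ENNReal.ofReal (exp (-(c * t) * ‖v‖ ^ 2)) := by
      rw [← ENNReal.ofReal_mul (by positivity), mul_assoc, ← exp_add]
      ring_nf
    simp_rw [hsplit]
    rw [lintegral_const_mul _ (by fun_prop), lintegral_exp_neg_mul_sq_norm (by positivity),
      ← ENNReal.ofReal_mul (by positivity), ← ENNReal.ofReal_mul (by positivity)]
    congr 1
    rw [← div_div, div_rpow (by positivity) ht.le, sub_right_comm, rpow_sub ht _ k]
    ring
  simp_rw [hmix]
  rw [lintegral_const_mul' _ _ ENNReal.ofReal_ne_top, lintegral_lintegral_swap (by fun_prop),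
    setLIntegral_congr_fun measurableSet_Ioi fun t ht => hgauss ht,
    lintegral_const_mul' _ _ ENNReal.ofReal_ne_top, lintegral_rpow_mul_exp_neg_mul_Ioi hak hw,
    ← ENNReal.ofReal_mul (by positivity), ← ENNReal.ofReal_mul (by positivity),
    one_div, inv_rpow hw.le, ← rpow_neg hw.le]
  congr 1
  ring

end

theorem norm_sq_smul_add_orthogonal {E : Type*} [NormedAddCommGroup E] [InnerProductSpace ℝ E]
    {u : E} (hu : ‖u‖ = 1) (z : ℝ) (v : (ℝ ∙ u)ᗮ) :
    ‖z • u + (v : E)‖ ^ 2 = z ^ 2 + ‖v‖ ^ 2 := by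
  have huv : ⟪u, (v : E)⟫ = 0 := Submodule.mem_orthogonal_singleton_iff_inner_right.1 v.2
  rw [norm_add_sq_real, inner_smul_left, huv, norm_smul, hu]
  simp

theorem lintegral_fC_orthogonal {d : ℕ} (hd : 1 ≤ d) {γ : ℝ} (hγ : 0 < γ)
    {u : EuclideanSpace ℝ (Fin d)} (hu : ‖u‖ = 1) (z : ℝ) :
    ∫⁻ v : (ℝ ∙ u)ᗮ, ENNReal.ofReal (fC d γ (z • u + v))
      = ENNReal.ofReal ((1 / (π * γ)) * (1 / (1 + (z / γ) ^ 2))) := by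
  obtain ⟨k, rfl⟩ := Nat.exists_eq_add_of_le' hd
  have : Fact (Module.finrank ℝ (EuclideanSpace ℝ (Fin (k + 1))) = k + 1) := ⟨by simp⟩
  have hrank : Module.finrank ℝ (ℝ ∙ u)ᗮ = k :=
    Submodule.finrank_orthogonal_span_singleton (norm_ne_zero_iff.1 (by simp [hu]))
  have hC : 0 ≤ cC (k + 1) * γ ^ (-((k + 1 : ℕ) : ℝ)) := by
    unfold cC
    push_cast
    positivity
  have hdens (v : (ℝ ∙ u)ᗮ) : ENNReal.ofReal (fC (k + 1) γ (z • u + v))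
      = ENNReal.ofReal (cC (k + 1) * γ ^ (-((k + 1 : ℕ) : ℝ)))
        * ENNReal.ofReal ((1 + (z / γ) ^ 2 + (γ ^ 2)⁻¹ * ‖v‖ ^ 2)
          ^ (-((((k + 1 : ℕ) : ℝ) + 1) / 2))) := by
    rw [← ENNReal.ofReal_mul hC, fC, norm_sq_smul_add_orthogonal hu]
    ring_nf
  simp_rw [hdens]
  rw [lintegral_const_mul' _ _ ENNReal.ofReal_ne_top,
    lintegral_add_mul_sq_norm_rpow_neg (by rw [hrank]; push_cast; linarith) (by positivity)
      (by positivity), ← ENNReal.ofReal_mul hC, hrank, cC]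
  have hexp : (((k + 1 : ℕ) : ℝ) + 1) / 2 - (k : ℝ) / 2 = 1 := by push_cast; ring
  have hexp' : (((k + 1 : ℕ) : ℝ) + 1) / 2 = (k : ℝ) / 2 + 1 := by push_cast; ring
  have hpow : (γ ^ 2) ^ ((k : ℝ) / 2) = γ ^ (k : ℝ) := by
    rw [← rpow_natCast, ← rpow_mul hγ.le]
    congr 1
    push_cast
    ring
  rw [hexp, Real.Gamma_one, hexp', div_inv_eq_mul, mul_rpow (by positivity) (by positivity), hpow,
    rpow_neg_one, rpow_neg hγ.le, rpow_add pi_pos, rpow_one, Nat.cast_succ, rpow_add hγ, rpow_one]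
  congr 1
  field_simp

theorem stmt1 (d : ℕ) (hd : 1 ≤ d) (γ : ℝ) (hγ : 0 < γ)
    (u : EuclideanSpace ℝ (Fin d)) (hu : ‖u‖ = 1) :
    Measure.map (fun n : EuclideanSpace ℝ (Fin d) => ⟪u, n⟫)
        (volume.withDensity fun n => ENNReal.ofReal (fC d γ n))
      = volume.withDensity fun z : ℝ =>
          ENNReal.ofReal ((1 / (π * γ)) * (1 / (1 + (z / γ) ^ 2))) := by
  have hf : Measurable fun n => ENNReal.ofReal (fC d γ n) := by
    unfold fC
    fun_prop
  have hproj : Measurable fun n : EuclideanSpace ℝ (Fin d) => ⟪u, n⟫ := by fun_prop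
  ext s hs
  rw [Measure.map_apply hproj hs, withDensity_apply _ (hproj hs), withDensity_apply _ hs,
    ← lintegral_indicator (hproj hs), ← lintegral_indicator hs,
    lintegral_eq_lintegral_span_singleton_orthogonal hu (hf.indicator (hproj hs))]
  congr with z
  have hinner (v : (ℝ ∙ u)ᗮ) : ⟪u, z • u + (v : EuclideanSpace ℝ (Fin d))⟫ = z := by
    rw [inner_add_right, inner_smul_right, real_inner_self_eq_norm_sq, hu,
      Submodule.mem_orthogonal_singleton_iff_inner_right.1 v.2]
    simp
  by_cases hz : z ∈ s
  · rw [Set.indicator_of_mem hz, ← lintegral_fC_orthogonal hd hγ hu]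
    simp [Set.indicator, hinner, hz]
  · simp [Set.indicator, hinner, hz]
end

section
/- Let C ⊂ ℝ^d be a finite set and let x ∈ C. Then the correct-decision probability converges, as the noise scale tends to infinity, to the isotropic Cauchy mass of the Voronoi recession cone: lim_{γ → ∞} ∫_{V(x) − x} f_γ(n) dn = ∫_{K(x)} c_d · (1 + ‖u‖²)^{−(d+1)/2} du. -/
open MeasureTheory Real Filter
open scoped RealInnerProductSpace Topology

/-- The Voronoi cell of `x` in the constellation `C`. -/
def vor {d : ℕ} (C : Set (EuclideanSpace ℝ (Fin d))) (x : EuclideanSpace ℝ (Fin d)) :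
    Set (EuclideanSpace ℝ (Fin d)) := {y | ∀ c ∈ C, ‖y - x‖ ≤ ‖y - c‖}

/-- The Voronoi cell of `x` translated by `-x`. -/
def vorT {d : ℕ} (C : Set (EuclideanSpace ℝ (Fin d))) (x : EuclideanSpace ℝ (Fin d)) :
    Set (EuclideanSpace ℝ (Fin d)) := (fun y => y - x) '' vor C x

/-- The recession cone of the Voronoi cell of `x`. -/
def recCone {d : ℕ} (C : Set (EuclideanSpace ℝ (Fin d))) (x : EuclideanSpace ℝ (Fin d)) :
    Set (EuclideanSpace ℝ (Fin d)) := {u | ∀ c ∈ C, ⟪u, c - x⟫ ≤ 0}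

/-- Correct-decision probability `P_c(x;γ)`. -/
noncomputable def Pc {d : ℕ} (C : Set (EuclideanSpace ℝ (Fin d)))
    (x : EuclideanSpace ℝ (Fin d)) (γ : ℝ) : ℝ :=
  ∫ n in vorT C x, fC d γ n

theorem mem_vorT_iff {d : ℕ} (C : Set (EuclideanSpace ℝ (Fin d)))
    (x u : EuclideanSpace ℝ (Fin d)) :
    u ∈ vorT C x ↔ ∀ c ∈ C, 2 * ⟪u, c - x⟫ ≤ ‖c - x‖ ^ 2 := by
  have key (c : EuclideanSpace ℝ (Fin d)) :
      ‖u‖ ≤ ‖u - (c - x)‖ ↔ 2 * ⟪u, c - x⟫ ≤ ‖c - x‖ ^ 2 := by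
    rw [← sq_le_sq₀ (norm_nonneg _) (norm_nonneg _), norm_sub_sq_real]
    constructor <;> intro h <;> linarith
  simp only [vorT, vor, Set.mem_image, Set.mem_ofPred_eq, ← key]
  constructor
  · rintro ⟨y, hy, rfl⟩ c hc
    simpa using hy c hc
  · intro h
    refine ⟨u + x, fun c hc => ?_, by simp⟩
    simpa [sub_sub_eq_add_sub] using h c hc

theorem isClosed_vorT {d : ℕ} (C : Set (EuclideanSpace ℝ (Fin d)))
    (x : EuclideanSpace ℝ (Fin d)) : IsClosed (vorT C x) := by
  have : vorT C x = ⋂ c ∈ C, {u | 2 * ⟪u, c - x⟫ ≤ ‖c - x‖ ^ 2} := by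
    ext u
    simp [mem_vorT_iff]
  rw [this]
  exact isClosed_biInter fun c _ => isClosed_le (by fun_prop) (by fun_prop)

theorem isClosed_recCone {d : ℕ} (C : Set (EuclideanSpace ℝ (Fin d)))
    (x : EuclideanSpace ℝ (Fin d)) : IsClosed (recCone C x) := by
  have : recCone C x = ⋂ c ∈ C, {u | ⟪u, c - x⟫ ≤ 0} := by
    ext u
    simp [recCone]
  rw [this]
  exact isClosed_biInter fun c _ => isClosed_le (by fun_prop) (by fun_prop)

/-- A point lies in the recession cone iff its large dilates lie in the translated cell. -/
theorem eventually_smul_mem_vorT_iff {d : ℕ} (C : Set (EuclideanSpace ℝ (Fin d)))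
    (x u : EuclideanSpace ℝ (Fin d)) :
    ∀ᶠ γ : ℝ in atTop, γ • u ∈ vorT C x ↔ u ∈ recCone C x := by
  simp only [mem_vorT_iff, real_inner_smul_left]
  by_cases hu : u ∈ recCone C x
  · filter_upwards [eventually_ge_atTop 0] with γ hγ
    refine iff_of_true (fun c hc => ?_) hu
    have := mul_nonpos_of_nonneg_of_nonpos hγ (hu c hc)
    nlinarith [sq_nonneg ‖c - x‖]
  · have hu' := hu
    simp only [recCone, Set.mem_ofPred_eq, not_forall, not_le] at hu'
    obtain ⟨c, hc, hpos⟩ := hu'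
    have hlim : Tendsto (fun γ : ℝ => 2 * (γ * ⟪u, c - x⟫)) atTop atTop :=
      (tendsto_id.atTop_mul_const hpos).const_mul_atTop two_pos
    filter_upwards [hlim.eventually_gt_atTop (‖c - x‖ ^ 2)] with γ hγ
    exact iff_of_false (fun h => (h c hc).not_gt hγ) hu

theorem fC_smul (d : ℕ) {γ : ℝ} (hγ : 0 < γ) (u : EuclideanSpace ℝ (Fin d)) :
    fC d γ (γ • u) = (γ ^ d)⁻¹ * fC d 1 u := by
  have : ‖γ • u‖ ^ 2 / γ ^ 2 = ‖u‖ ^ 2 := by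
    rw [norm_smul, Real.norm_of_nonneg hγ.le]
    field_simp
  simp only [fC, this, rpow_neg hγ.le, rpow_natCast, one_rpow]
  simp only [one_pow, div_one]
  ring

theorem Pc_eq_integral_indicator {d : ℕ} (C : Set (EuclideanSpace ℝ (Fin d)))
    (x : EuclideanSpace ℝ (Fin d)) {γ : ℝ} (hγ : 0 < γ) :
    Pc C x γ = ∫ u, ((γ • ·) ⁻¹' vorT C x).indicator (fC d 1) u := by
  have h := Measure.integral_comp_smul_of_nonneg volume ((vorT C x).indicator (fC d γ)) γ
    (hR := hγ.le)
  have hpt (u : EuclideanSpace ℝ (Fin d)) : (vorT C x).indicator (fC d γ) (γ • u) =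
      (γ ^ d)⁻¹ * ((γ • ·) ⁻¹' vorT C x).indicator (fC d 1) u := by
    by_cases hu : γ • u ∈ vorT C x
    · rw [Set.indicator_of_mem hu, Set.indicator_of_mem (Set.mem_preimage.2 hu), fC_smul d hγ]
    · rw [Set.indicator_of_notMem hu, Set.indicator_of_notMem (mt Set.mem_preimage.1 hu), mul_zero]
  simp only [hpt, integral_const_mul, finrank_euclideanSpace_fin, smul_eq_mul] at h
  rw [Pc, ← integral_indicator (isClosed_vorT C x).measurableSet]
  exact (mul_left_cancel₀ (by positivity) h).symm

theorem integrable_fC_one (d : ℕ) : Integrable (fC d 1) := by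
  have h := integrable_rpow_neg_one_add_norm_sq (E := EuclideanSpace ℝ (Fin d)) (μ := volume)
    (r := (d : ℝ) + 1) (by simp)
  convert! h.const_mul (cC d) using 2 with u
  rw [neg_div]
  simp [fC]

theorem stmt10 (d : ℕ) (hd : 1 ≤ d) (C : Set (EuclideanSpace ℝ (Fin d))) (hC : C.Finite)
    (x : EuclideanSpace ℝ (Fin d)) (hx : x ∈ C) :
    Tendsto (fun γ : ℝ => Pc C x γ) atTop
      (nhds (∫ u in recCone C x, cC d * (1 + ‖u‖ ^ 2) ^ (-(((d : ℝ) + 1) / 2)))) := by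
  have hlimit : (fun u : EuclideanSpace ℝ (Fin d) =>
      cC d * (1 + ‖u‖ ^ 2) ^ (-(((d : ℝ) + 1) / 2))) = fC d 1 := by
    ext u
    simp [fC]
  rw [hlimit, ← integral_indicator (isClosed_recCone C x).measurableSet]
  refine Tendsto.congr' (f₁ := fun γ => ∫ u, ((γ • ·) ⁻¹' vorT C x).indicator (fC d 1) u) ?_ ?_
  · filter_upwards [eventually_gt_atTop 0] with γ hγ
    exact (Pc_eq_integral_indicator C x hγ).symm
  refine tendsto_integral_filter_of_dominated_convergence (fun u => ‖fC d 1 u‖)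
    (.of_forall fun γ => ?_) (.of_forall fun γ => .of_forall fun u => norm_indicator_le_norm_self _ _)
    (integrable_fC_one d).norm (.of_forall fun u => ?_)
  · exact (integrable_fC_one d).aestronglyMeasurable.indicator
      ((isClosed_vorT C x).preimage (continuous_const_smul γ)).measurableSet
  · refine tendsto_const_nhds.congr' ?_
    filter_upwards [eventually_smul_mem_vorT_iff C x u] with γ hγ
    by_cases hu : u ∈ recCone C x
    · rw [Set.indicator_of_mem hu, Set.indicator_of_mem (Set.mem_preimage.2 (hγ.2 hu))]
    · rw [Set.indicator_of_notMem hu, Set.indicator_of_notMem (mt (Set.mem_preimage.trans hγ).1 hu)]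
end
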